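/- Let α be a primitive cube root of unity in F_{q²}¹ and A = [[α, −α², −α/(1+α²)],[0, α, 1],[0, 0, α]] ∈ SU_3(q) (char ≠ 2, 3). Then A is conjugate to its transpose by an element of SU_3(q) if and only if the equation X³ = α has a solution in F_{q²}. -/

import Mathlib

theorem pow_succ_eq_one_of_cube_eq {q : ℕ} {K : Type*} [Field K] [Fintype K]
    (hK : Fintype.card K = q ^ 2) {α x : K} (hα : IsPrimitiveRoot α 3)
    (hnorm : α ^ (q + 1) = 1) (hx : x ^ 3 = α) : x ^ (q + 1) = 1 := by
  have hy3 : (x ^ (q + 1)) ^ 3 = 1 := by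
    rw [← pow_mul, mul_comm, pow_mul, hx, hnorm]
  have hq : x ^ (q ^ 2) = x := by rw [← hK]; exact FiniteField.pow_card x
  have hyq : (x ^ (q + 1)) ^ q = x ^ (q + 1) := by
    rw [← pow_mul, show (q + 1) * q = q ^ 2 + q by ring, pow_add, hq, pow_succ, mul_comm]
  have hy1 : (x ^ (q + 1)) ^ (q + 1) = 1 :=
    orderOf_dvd_iff_pow_eq_one.1 ((orderOf_dvd_of_pow_eq_one hy3).trans
      (hα.dvd_of_pow_eq_one _ hnorm))
  rw [pow_succ, hyq] at hy1
  linear_combination hy3 - x ^ (q + 1) * hy1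

theorem odd_of_card_eq_sq {q : ℕ} {K : Type*} [Field K] [Fintype K]
    (hK : Fintype.card K = q ^ 2) (hchar2 : ringChar K ≠ 2) : Odd q := by
  have h := FiniteField.odd_card_of_char_ne_two hchar2
  rw [hK, ← Nat.odd_iff] at h
  exact (Nat.odd_pow_iff two_ne_zero).1 h

theorem stmt18 (q : ℕ) (K : Type*) [Field K] [Fintype K]
    (hK : Fintype.card K = q ^ 2) (hchar2 : ringChar K ≠ 2) (hchar3 : ringChar K ≠ 3)
    (α : K) (hα : IsPrimitiveRoot α 3) (hnorm : α ^ (q + 1) = 1) :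
    let B : Matrix (Fin 3) (Fin 3) K := !![0, 0, 1; 0, 1, 0; 1, 0, 0]
    let A : Matrix (Fin 3) (Fin 3) K :=
      !![α, -α ^ 2, -α / (1 + α ^ 2); 0, α, 1; 0, 0, α]
    (∃ g : Matrix (Fin 3) (Fin 3) K, g.det = 1 ∧
        g.transpose * B * (g.map (fun x => x ^ q)) = B ∧
        g * A * g⁻¹ = A.transpose) ↔
      ∃ x : K, x ^ 3 = α := by
  intro B A
  have hα0 : α ≠ 0 := hα.ne_zero (by norm_num)
  have hα3 : α ^ 3 = 1 := hα.pow_eq_one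
  have hsum : 1 + α ^ 2 = -α := by
    have h1 : α - 1 ≠ 0 := sub_ne_zero.2 (hα.ne_one (by norm_num))
    apply mul_left_cancel₀ h1
    linear_combination hα3
  have hA : A = !![α, -α ^ 2, 1; 0, α, 1; 0, 0, α] := by
    simp only [A]
    rw [hsum, div_self (neg_ne_zero.2 hα0)]
  constructor
  · rintro ⟨g, hdet, -, hconj⟩
    have hu : IsUnit g.det := by rw [hdet]; exact isUnit_one
    have hgA : g * A = A.transpose * g := by
      rw [← hconj, Matrix.nonsing_inv_mul_cancel_right _ _ hu]
    rw [hA] at hgA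
    have e := fun i j => congrFun (congrFun hgA i) j
    have e01 := e 0 1
    have e02 := e 0 2
    have e11 := e 1 1
    have e12 := e 1 2
    have e21 := e 2 1
    simp [Matrix.mul_apply, Fin.sum_univ_three] at e01 e02 e11 e12 e21
    have h00 : g 0 0 = 0 := by
      have : α ^ 2 * g 0 0 = 0 := by grind
      exact (mul_eq_zero.1 this).resolve_left (pow_ne_zero 2 hα0)
    have h01 : g 0 1 = 0 := by grind
    have h10 : g 1 0 = 0 := by
      have : α ^ 2 * g 1 0 = 0 := by grind
      exact (mul_eq_zero.1 this).resolve_left (pow_ne_zero 2 hα0)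
    have h11 : g 1 1 = -α ^ 2 * g 0 2 := by grind
    have h20 : g 2 0 = g 0 2 := by
      apply mul_left_cancel₀ (pow_ne_zero 2 hα0)
      grind
    refine ⟨g 0 2, ?_⟩
    rw [Matrix.det_fin_three, h00, h01, h10, h11, h20] at hdet
    linear_combination α * hdet - (g 0 2) ^ 3 * hα3
  · rintro ⟨b, hb⟩
    have hbq := pow_succ_eq_one_of_cube_eq hK hα hnorm hb
    have hodd := odd_of_card_eq_sq hK hchar2
    have hq0 : q ≠ 0 := hodd.pos.ne'
    have hmid : (-(α ^ 2 * b)) * (-(α ^ 2 * b)) ^ q = 1 := by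
      rw [← pow_succ', hodd.add_one.neg_pow, mul_pow, hbq, ← pow_mul, mul_comm 2, pow_mul, hnorm]
      simp
    have hbb : b * b ^ q = 1 := by rw [← pow_succ', hbq]
    have hdet : (!![0, 0, b; 0, -(α ^ 2 * b), 0; b, 0, 0] : Matrix (Fin 3) (Fin 3) K).det = 1 := by
      rw [Matrix.det_fin_three]
      simp
      linear_combination α ^ 2 * hb + hα3
    refine ⟨!![0, 0, b; 0, -(α ^ 2 * b), 0; b, 0, 0], hdet, ?_, ?_⟩
    · ext i j
      fin_cases i <;> fin_cases j <;>
        simp [B, Matrix.mul_apply, Fin.sum_univ_three, hq0, hbb]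
      simpa using hmid
    · rw [hA]
      have hcomm : (!![0, 0, b; 0, -(α ^ 2 * b), 0; b, 0, 0] : Matrix (Fin 3) (Fin 3) K) *
          !![α, -α ^ 2, 1; 0, α, 1; 0, 0, α] =
          (!![α, -α ^ 2, 1; 0, α, 1; 0, 0, α] : Matrix (Fin 3) (Fin 3) K).transpose *
            !![0, 0, b; 0, -(α ^ 2 * b), 0; b, 0, 0] := by
        ext i j
        fin_cases i <;> fin_cases j <;>
          simp [Matrix.mul_apply, Fin.sum_univ_three] <;> ring
      rw [hcomm, Matrix.mul_nonsing_inv_cancel_right _ _ (by rw [hdet]; exact isUnit_one)]
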